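/- (Gallagher's theorem, divergence case.) Let n ≥ 1 and let ψ : ℕ → (0,∞) be an approximating function. If Σ_{h=2}^∞ ψ(h)^n (log h)^{n−1} = ∞, then the set S_n*(ψ) has full n-dimensional Lebesgue measure, i.e. the complement of S_n*(ψ) in [0,1]^n has Lebesgue measure zero. -/

import Mathlib

open MeasureTheory

/-- Distance from `x` to the nearest integer, `‖x‖ = min_{z ∈ ℤ} |x - z|`. -/
noncomputable def nint (x : ℝ) : ℝ := ⨅ z : ℤ, |x - (z : ℝ)|

/-- `S_n*(ψ)`: points `x ∈ ℝⁿ` with `∏ᵢ ‖q xᵢ‖ < ψ(q)` for infinitely many `q ∈ ℕ`. -/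
def SnStar (n : ℕ) (ψ : ℕ → ℝ) : Set (Fin n → ℝ) :=
  { x | {q : ℕ | 0 < q ∧ ∏ i, nint (q * x i) < ψ q}.Infinite }

/-- Coprime pairs `(a, b)` with `a ≤ 16 L` and `L < b ≤ 16 L`. -/
def coprimePairs (L : ℕ) : Finset (ℕ × ℕ) :=
  (Finset.Ioc 0 (16 * L) ×ˢ Finset.Ioc L (16 * L)).filter fun p => p.1.Coprime p.2

/-- The fractions `a / (a + b)` for `(a, b)` ranging over `coprimePairs (32 ^ k)`; their reduced
denominators lie in `(32 ^ k, 32 ^ (k + 1)]`. -/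
noncomputable def fareyBlock (k : ℕ) : Finset ℝ :=
  (coprimePairs (32 ^ k)).image fun p => (p.1 : ℝ) / (p.1 + p.2 : ℕ)

lemma sum_inv_sq_le {N : ℕ} (hN : 2 ≤ N) :
    ∑ d ∈ Finset.Icc 2 N, (1 / (d : ℝ) ^ 2) ≤ 3 / 4 - 1 / (N : ℝ) := by
  induction N, hN using Nat.le_induction with
  | base => norm_num
  | succ n hn ih =>
    rw [Finset.sum_Icc_succ_top (by omega)]
    have hn' : (0 : ℝ) < n := by positivity
    have : 1 / ((n + 1 : ℕ) : ℝ) ^ 2 ≤ 1 / n - 1 / (n + 1 : ℕ) := by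
      push_cast
      rw [div_sub_div _ _ (by positivity) (by positivity), div_le_div_iff₀ (by positivity)
        (by positivity)]
      nlinarith
    linarith

lemma card_not_coprime_le (N : ℕ) :
    ((((Finset.Ioc 0 N ×ˢ Finset.Ioc 0 N).filter fun p => ¬ p.1.Coprime p.2).card : ℕ) : ℝ)
      ≤ 3 / 4 * (N : ℝ) ^ 2 := by
  have hsub : ((Finset.Ioc 0 N ×ˢ Finset.Ioc 0 N).filter fun p => ¬ p.1.Coprime p.2) ⊆
      (Finset.Icc 2 N).biUnion fun d =>
        (Finset.Ioc 0 N ×ˢ Finset.Ioc 0 N).filter fun p => d ∣ p.1 ∧ d ∣ p.2 := by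
    rintro ⟨a, b⟩ h
    simp only [Finset.mem_filter, Finset.mem_product, Finset.mem_Ioc] at h
    simp only [Finset.mem_biUnion, Finset.mem_filter, Finset.mem_product, Finset.mem_Ioc,
      Finset.mem_Icc]
    have h1 : Nat.gcd a b ≠ 1 := h.2
    have h2 : 0 < Nat.gcd a b := Nat.gcd_pos_of_pos_left _ h.1.1.1
    have h3 : Nat.gcd a b ≤ a := Nat.gcd_le_left _ h.1.1.1
    exact ⟨Nat.gcd a b, ⟨by omega, by omega⟩, h.1, Nat.gcd_dvd_left _ _, Nat.gcd_dvd_right _ _⟩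
  have hcard := (Finset.card_le_card hsub).trans Finset.card_biUnion_le
  simp only [Finset.filter_product, Finset.card_product, Nat.Ioc_filter_dvd_card_eq_div] at hcard
  rcases lt_or_ge N 2 with hN | hN
  · rw [Finset.Icc_eq_empty (by omega), Finset.sum_empty] at hcard
    have : (0 : ℝ) ≤ 3 / 4 * (N : ℝ) ^ 2 := by positivity
    refine le_trans ?_ this
    exact_mod_cast hcard
  calc ((((Finset.Ioc 0 N ×ˢ Finset.Ioc 0 N).filter fun p => ¬ p.1.Coprime p.2).card : ℕ) : ℝ)
      ≤ ∑ d ∈ Finset.Icc 2 N, ((N / d : ℕ) : ℝ) * ((N / d : ℕ) : ℝ) := by exact_mod_cast hcard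
    _ ≤ ∑ d ∈ Finset.Icc 2 N, (N : ℝ) ^ 2 * (1 / (d : ℝ) ^ 2) := by
        refine Finset.sum_le_sum fun d _ => ?_
        have h : ((N / d : ℕ) : ℝ) ≤ N / d := Nat.cast_div_le
        calc ((N / d : ℕ) : ℝ) * ((N / d : ℕ) : ℝ) ≤ (N / d) * (N / d) := by gcongr
          _ = _ := by ring
    _ ≤ 3 / 4 * (N : ℝ) ^ 2 := by
        rw [← Finset.mul_sum, mul_comm]
        gcongr
        exact (sum_inv_sq_le hN).trans (by linarith [show (0 : ℝ) ≤ 1 / N by positivity])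

lemma le_card_coprimePairs (L : ℕ) : 48 * (L : ℝ) ^ 2 ≤ (coprimePairs L).card := by
  classical
  set N := 16 * L with hN
  have hsub : Finset.Ioc 0 N ×ˢ Finset.Ioc 0 N ⊆ coprimePairs L ∪
      (((Finset.Ioc 0 N ×ˢ Finset.Ioc 0 N).filter fun p => ¬ p.1.Coprime p.2) ∪
        Finset.Ioc 0 N ×ˢ Finset.Ioc 0 L) := by
    rintro ⟨a, b⟩ h
    simp only [coprimePairs, Finset.mem_union, Finset.mem_filter, Finset.mem_product,
      Finset.mem_Ioc, ← hN] at h ⊢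
    by_cases h1 : a.Coprime b <;> by_cases h2 : L < b <;> simp [h1, h2] <;> omega
  have h := ((Finset.card_le_card hsub).trans (Finset.card_union_le _ _)).trans
    (Nat.add_le_add_left (Finset.card_union_le _ _) _)
  simp only [Finset.card_product, Nat.card_Ioc, tsub_zero] at h
  have h1 : (N : ℝ) * N ≤ (coprimePairs L).card +
      ((((Finset.Ioc 0 N ×ˢ Finset.Ioc 0 N).filter fun p => ¬ p.1.Coprime p.2).card : ℕ) +
        (N : ℝ) * L) := by exact_mod_cast h
  have h2 := card_not_coprime_le N
  have h3 : (N : ℝ) = 16 * L := by simp [hN]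
  rw [h3] at h1 h2
  linarith

lemma card_coprimePairs_le (L : ℕ) : ((coprimePairs L).card : ℝ) ≤ 256 * (L : ℝ) ^ 2 := by
  have h := Finset.card_filter_le (Finset.Ioc 0 (16 * L) ×ˢ Finset.Ioc L (16 * L))
    fun p => p.1.Coprime p.2
  rw [Finset.card_product, Nat.card_Ioc, Nat.card_Ioc, tsub_zero] at h
  have h' : (coprimePairs L).card ≤ 16 * L * (16 * L) :=
    h.trans (Nat.mul_le_mul_left _ (Nat.sub_le _ _))
  calc ((coprimePairs L).card : ℝ) ≤ ((16 * L * (16 * L) : ℕ) : ℝ) := by exact_mod_cast h'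
    _ = _ := by push_cast; ring

lemma eq_of_coprime_of_mul_eq {a b c d : ℕ} (hab : a.Coprime b) (hcd : c.Coprime d)
    (h : a * d = c * b) : a = c ∧ b = d := by
  refine ⟨Nat.dvd_antisymm ?_ ?_, Nat.dvd_antisymm ?_ ?_⟩
  · exact hab.dvd_of_dvd_mul_right ⟨d, h.symm⟩
  · exact hcd.dvd_of_dvd_mul_right ⟨b, h⟩
  · exact hab.symm.dvd_of_dvd_mul_left ⟨c, by rw [h, mul_comm]⟩
  · exact hcd.symm.dvd_of_dvd_mul_left ⟨a, by rw [← h, mul_comm]⟩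

lemma mul_eq_of_div_eq {a b c d : ℕ} (hb : 0 < b) (hd : 0 < d)
    (h : (a : ℝ) / b = (c : ℝ) / d) : a * d = c * b := by
  rw [div_eq_div_iff (by positivity) (by positivity)] at h
  exact_mod_cast h

lemma exists_of_mem_fareyBlock {k : ℕ} {x : ℝ} (hx : x ∈ fareyBlock k) :
    ∃ a q : ℕ, 0 < a ∧ a < q ∧ a.Coprime q ∧ 32 ^ k < q ∧ q ≤ 32 ^ (k + 1) ∧ x = a / q := by
  simp only [fareyBlock, coprimePairs, Finset.mem_image, Finset.mem_filter, Finset.mem_product,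
    Finset.mem_Ioc] at hx
  obtain ⟨⟨a, b⟩, ⟨⟨h1, h2⟩, h3⟩, rfl⟩ := hx
  dsimp only at *
  refine ⟨a, a + b, by omega, by omega, by simpa using h3, by omega, ?_, rfl⟩
  rw [pow_succ]
  omega

lemma card_fareyBlock (k : ℕ) : (fareyBlock k).card = (coprimePairs (32 ^ k)).card := by
  refine Finset.card_image_of_injOn ?_
  rintro ⟨a, b⟩ h1 ⟨c, d⟩ h2 h
  simp only [coprimePairs, Finset.coe_filter, Finset.mem_product, Finset.mem_Ioc,
    Set.mem_ofPred_eq] at h1 h2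
  have h' := mul_eq_of_div_eq (by omega) (by omega) h
  obtain ⟨rfl, h''⟩ := eq_of_coprime_of_mul_eq (b := a + b) (d := c + d) (by simpa using h1.2)
    (by simpa using h2.2) h'
  simp only [Prod.mk.injEq, true_and]
  omega

lemma le_card_fareyBlock (k : ℕ) : ((32 : ℝ) ^ (k + 1)) ^ 2 / 32 ≤ (fareyBlock k).card := by
  have h := le_card_coprimePairs (32 ^ k)
  rw [card_fareyBlock]
  push_cast at h
  refine le_trans ?_ h
  rw [pow_succ (32 : ℝ) k]
  nlinarith [sq_nonneg ((32 : ℝ) ^ k)]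

lemma card_fareyBlock_le (k : ℕ) : ((fareyBlock k).card : ℝ) ≤ ((32 : ℝ) ^ (k + 1)) ^ 2 / 4 := by
  have h := card_coprimePairs_le (32 ^ k)
  rw [card_fareyBlock]
  push_cast at h
  refine h.trans ?_
  rw [pow_succ (32 : ℝ) k]
  nlinarith [sq_nonneg ((32 : ℝ) ^ k)]

lemma fareyBlock_separated {k l : ℕ} {x y : ℝ} (hx : x ∈ fareyBlock k) (hy : y ∈ fareyBlock l)
    (hxy : x ≠ y) : 1 / ((32 : ℝ) ^ (k + 1) * 32 ^ (l + 1)) ≤ |x - y| := by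
  obtain ⟨a, q, ha, haq, -, -, hq, rfl⟩ := exists_of_mem_fareyBlock hx
  obtain ⟨c, r, hc, hcr, -, -, hr, rfl⟩ := exists_of_mem_fareyBlock hy
  have hq0 : (0 : ℝ) < q := by exact_mod_cast (by omega : 0 < q)
  have hr0 : (0 : ℝ) < r := by exact_mod_cast (by omega : 0 < r)
  have hq' : (q : ℝ) ≤ 32 ^ (k + 1) := by exact_mod_cast hq
  have hr' : (r : ℝ) ≤ 32 ^ (l + 1) := by exact_mod_cast hr
  rw [div_sub_div _ _ hq0.ne' hr0.ne', abs_div, abs_of_pos (mul_pos hq0 hr0)]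
  have hne : (a * r - q * c : ℤ) ≠ 0 := by
    intro h
    apply hxy
    rw [div_eq_div_iff hq0.ne' hr0.ne']
    have h' : (a * r : ℤ) = c * q := by linarith
    exact_mod_cast h'
  have h1 : (1 : ℝ) ≤ |(a * r - q * c : ℝ)| := by
    exact_mod_cast Int.one_le_abs hne
  gcongr

lemma ne_of_mem_fareyBlock {k l : ℕ} (hkl : k < l) {x y : ℝ} (hx : x ∈ fareyBlock k)
    (hy : y ∈ fareyBlock l) : x ≠ y := by
  obtain ⟨a, q, ha, haq, h1, -, hq, rfl⟩ := exists_of_mem_fareyBlock hx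
  obtain ⟨c, r, hc, hcr, h2, hr, -, rfl⟩ := exists_of_mem_fareyBlock hy
  intro h
  have h' := (eq_of_coprime_of_mul_eq h1 h2 (mul_eq_of_div_eq (by omega) (by omega) h)).2
  have : 32 ^ (k + 1) ≤ 32 ^ l := Nat.pow_le_pow_right (by norm_num) hkl
  omega

/-- The union of the balls of radius `t / 32 ^ (2 * (k + 1))` about the points of `fareyBlock k`. -/
noncomputable def fareyNhd (k : ℕ) (t : ℝ) : Set ℝ :=
  ⋃ x ∈ fareyBlock k, Metric.ball x (t / ((32 : ℝ) ^ (k + 1)) ^ 2)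

lemma measurableSet_fareyNhd (k : ℕ) (t : ℝ) : MeasurableSet (fareyNhd k t) :=
  Finset.measurableSet_biUnion _ fun _ _ => measurableSet_ball

lemma fareyNhd_subset {k : ℕ} {t : ℝ} (ht : t ≤ 1 / 80) :
    fareyNhd k t ⊆ Set.Ioc 0 1 := by
  intro y hy
  simp only [fareyNhd, Set.mem_iUnion, Metric.mem_ball, exists_prop, Real.dist_eq] at hy
  obtain ⟨x, hx, hyx⟩ := hy
  obtain ⟨a, q, ha, haq, -, -, hq, rfl⟩ := exists_of_mem_fareyBlock hx
  have hq0 : (0 : ℝ) < q := by exact_mod_cast (by omega : 0 < q)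
  have hq1 : (1 : ℝ) ≤ q := by exact_mod_cast (by omega : 1 ≤ q)
  have hq' : (q : ℝ) ≤ 32 ^ (k + 1) := by exact_mod_cast hq
  have h1 : t / ((32 : ℝ) ^ (k + 1)) ^ 2 ≤ 1 / q := by
    calc t / ((32 : ℝ) ^ (k + 1)) ^ 2 ≤ 1 / ((32 : ℝ) ^ (k + 1)) ^ 2 := by gcongr; linarith
      _ ≤ 1 / (q : ℝ) ^ 2 := by gcongr
      _ ≤ 1 / q := by gcongr; nlinarith
  have h2 : 1 / (q : ℝ) ≤ a / q := by gcongr; exact_mod_cast ha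
  have h3 : (a : ℝ) / q + 1 / q ≤ 1 := by
    rw [← add_div, div_le_one hq0]; exact_mod_cast haq
  rw [abs_lt] at hyx
  constructor <;> linarith

lemma volume_fareyNhd_ne_top {k : ℕ} {t : ℝ} (ht : t ≤ 1 / 80) : volume (fareyNhd k t) ≠ ⊤ :=
  ((measure_mono (fareyNhd_subset ht)).trans_lt measure_Ioc_lt_top).ne

lemma le_volume_fareyNhd {k : ℕ} {t : ℝ} (ht0 : 0 ≤ t) (ht : t ≤ 1 / 80) :
    t / 16 ≤ volume.real (fareyNhd k t) := by
  have hQ : (0 : ℝ) < (32 : ℝ) ^ (k + 1) := by positivity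
  rw [fareyNhd, measureReal_biUnion_finset]
  · simp only [Real.volume_real_ball (show 0 ≤ t / ((32 : ℝ) ^ (k + 1)) ^ 2 by positivity),
      Finset.sum_const, nsmul_eq_mul]
    calc t / 16 = ((32 : ℝ) ^ (k + 1)) ^ 2 / 32 * (2 * (t / ((32 : ℝ) ^ (k + 1)) ^ 2)) := by
          field_simp; ring
      _ ≤ _ := by gcongr; exact le_card_fareyBlock k
  · intro x hx y hy hxy
    refine Metric.ball_disjoint_ball ?_
    rw [Real.dist_eq]
    refine le_trans ?_ (fareyBlock_separated hx hy hxy)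
    rw [← add_div, pow_two]
    gcongr
    linarith
  · exact fun _ _ => measurableSet_ball

lemma card_filter_fareyBlock_le {l : ℕ} (x : ℝ) {ρ : ℝ} (hρ : 0 ≤ ρ) :
    (((fareyBlock l).filter fun y => |x - y| < ρ).card : ℝ) ≤
      2 * ρ * ((32 : ℝ) ^ (l + 1)) ^ 2 + 2 := by
  set R : ℝ := ((32 : ℝ) ^ (l + 1)) ^ 2 with hR
  have hR0 : 0 < R := by positivity
  have h := Finset.card_le_card_of_injOn (s := (fareyBlock l).filter fun y => |x - y| < ρ)
    (t := Finset.Icc ⌊(x - ρ) * R⌋ ⌊(x + ρ) * R⌋) (fun y => ⌊y * R⌋) ?_ ?_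
  · rw [Int.card_Icc] at h
    have h1 := Int.floor_le ((x + ρ) * R)
    have h2 := Int.lt_floor_add_one ((x - ρ) * R)
    have h3 : ⌊(x - ρ) * R⌋ ≤ ⌊(x + ρ) * R⌋ := Int.floor_le_floor (by gcongr; linarith)
    have h4 : (((fareyBlock l).filter fun y => |x - y| < ρ).card : ℤ) ≤
        ⌊(x + ρ) * R⌋ + 1 - ⌊(x - ρ) * R⌋ := by omega
    have h5 : (((fareyBlock l).filter fun y => |x - y| < ρ).card : ℝ) ≤
        ⌊(x + ρ) * R⌋ + 1 - ⌊(x - ρ) * R⌋ := by exact_mod_cast h4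
    linarith
  · intro y hy
    simp only [Finset.coe_filter, Set.mem_ofPred_eq, abs_lt] at hy
    simp only [Finset.coe_Icc, Set.mem_Icc]
    constructor <;> refine Int.floor_le_floor ?_ <;> gcongr <;> linarith
  · intro y hy z hz hyz
    by_contra hne
    have hy' : y ∈ fareyBlock l := (Finset.mem_filter.mp hy).1
    have hz' : z ∈ fareyBlock l := (Finset.mem_filter.mp hz).1
    have h1 := fareyBlock_separated hy' hz' hne
    have h2 := Int.abs_sub_lt_one_of_floor_eq_floor hyz
    rw [← sub_mul, abs_mul, abs_of_pos hR0] at h2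
    rw [← pow_two, div_le_iff₀ hR0] at h1
    linarith

lemma volume_fareyNhd_inter_le {k l : ℕ} (hkl : k < l) {s t : ℝ} (hs0 : 0 ≤ s)
    (ht0 : 0 ≤ t) (ht : t ≤ 1 / 80) :
    volume.real (fareyNhd k s ∩ fareyNhd l t) ≤ 5 / 2 * (s * t) := by
  set K : ℝ := (32 : ℝ) ^ (k + 1) with hK
  set M : ℝ := (32 : ℝ) ^ (l + 1) with hM
  have hK0 : 0 < K := by positivity
  have hM0 : 0 < M := by positivity
  have hKM : 32 * K ≤ M := by
    rw [hK, hM, ← pow_succ']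
    exact pow_le_pow_right₀ (by norm_num) (by omega)
  have hsub : fareyNhd k s ∩ fareyNhd l t ⊆ ⋃ x ∈ fareyBlock k,
      ⋃ y ∈ (fareyBlock l).filter fun y => |x - y| < s / K ^ 2 + t / M ^ 2,
        Metric.ball y (t / M ^ 2) := by
    rintro z ⟨hz1, hz2⟩
    simp only [fareyNhd, Set.mem_iUnion, exists_prop] at hz1 hz2
    obtain ⟨x, hx, hzx⟩ := hz1
    obtain ⟨y, hy, hzy⟩ := hz2
    simp only [Set.mem_iUnion, exists_prop, Finset.mem_filter]
    refine ⟨x, hx, y, ⟨hy, ?_⟩, hzy⟩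
    rw [Metric.mem_ball, Real.dist_eq] at hzx hzy
    rw [abs_sub_comm] at hzx
    calc |x - y| ≤ |x - z| + |z - y| := abs_sub_le _ _ _
      _ < _ := by gcongr
  have hcard : ∀ x ∈ fareyBlock k,
      (((fareyBlock l).filter fun y => |x - y| < s / K ^ 2 + t / M ^ 2).card : ℝ) ≤
        5 * (s / K ^ 2) * M ^ 2 := by
    intro x hx
    rcases Finset.eq_empty_or_nonempty
      ((fareyBlock l).filter fun y => |x - y| < s / K ^ 2 + t / M ^ 2) with he | ⟨y, hy⟩
    · rw [he, Finset.card_empty, Nat.cast_zero]; positivity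
    rw [Finset.mem_filter] at hy
    have h1 := (fareyBlock_separated hx hy.1 (ne_of_mem_fareyBlock hkl hx hy.1)).trans_lt hy.2
    rw [← hK, ← hM] at h1
    have h2 : t / M ^ 2 ≤ 1 / 80 * (1 / (K * M)) := by
      rw [← div_eq_mul_one_div, pow_two]
      gcongr
      linarith
    have h3 : 2 ≤ s / K ^ 2 * M ^ 2 - 2 * t := by
      have h : 79 / 80 * (1 / (K * M)) * M ^ 2 ≤ s / K ^ 2 * M ^ 2 := by gcongr; linarith
      have h' : 1 / (K * M) * M ^ 2 = M / K := by field_simp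
      have h'' : 32 ≤ M / K := by rwa [le_div_iff₀ hK0]
      nlinarith
    have h4 := card_filter_fareyBlock_le (l := l) x
      (show 0 ≤ s / K ^ 2 + t / M ^ 2 by positivity)
    rw [← hM] at h4
    have h5 : t / M ^ 2 * M ^ 2 = t := by field_simp
    linarith
  calc volume.real (fareyNhd k s ∩ fareyNhd l t)
      ≤ volume.real (⋃ x ∈ fareyBlock k,
        ⋃ y ∈ (fareyBlock l).filter fun y => |x - y| < s / K ^ 2 + t / M ^ 2,
          Metric.ball y (t / M ^ 2)) := by
        refine measureReal_mono hsub (ne_of_lt ?_)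
        refine (measure_biUnion_lt_top (Finset.finite_toSet _) fun x _ => ?_)
        exact (measure_biUnion_lt_top (Finset.finite_toSet _) fun y _ => measure_ball_lt_top)
    _ ≤ ∑ x ∈ fareyBlock k, 5 * (s / K ^ 2) * M ^ 2 * (2 * (t / M ^ 2)) := by
        refine (measureReal_biUnion_finset_le _ _).trans (Finset.sum_le_sum fun x hx => ?_)
        refine (measureReal_biUnion_finset_le _ _).trans ?_
        simp only [Real.volume_real_ball (show 0 ≤ t / M ^ 2 by positivity),
          Finset.sum_const, nsmul_eq_mul]
        gcongr
        exact hcard x hx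
    _ ≤ K ^ 2 / 4 * (5 * (s / K ^ 2) * M ^ 2 * (2 * (t / M ^ 2))) := by
        rw [Finset.sum_const, nsmul_eq_mul]
        gcongr
        exact card_fareyBlock_le k
    _ = 5 / 2 * (s * t) := by field_simp; ring

lemma le_volume_biUnion_fareyNhd {t : ℕ → ℝ} (ht0 : ∀ k, 0 ≤ t k) (ht : ∀ k, t k ≤ 1 / 80)
    (m n : ℕ) :
    (∑ k ∈ Finset.Ico m n, t k) / 16 - 5 / 4 * (∑ k ∈ Finset.Ico m n, t k) ^ 2 ≤
      volume.real (⋃ k ∈ Finset.Ico m n, fareyNhd k (t k)) := by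
  induction n with
  | zero => simp
  | succ n ih =>
    rcases lt_or_ge n m with hmn | hmn
    · simp [Finset.Ico_eq_empty_of_le (show n + 1 ≤ m by omega)]
    have hfin : volume (⋃ k ∈ Finset.Ico m n, fareyNhd k (t k)) ≠ ⊤ :=
      (measure_biUnion_lt_top (Finset.finite_toSet _) fun k _ =>
        (volume_fareyNhd_ne_top (ht k)).lt_top).ne
    have hunion := measureReal_union_add_inter
      (s := ⋃ k ∈ Finset.Ico m n, fareyNhd k (t k)) (measurableSet_fareyNhd n (t n)) hfin
      (volume_fareyNhd_ne_top (ht n))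
    have hinter : volume.real ((⋃ k ∈ Finset.Ico m n, fareyNhd k (t k)) ∩ fareyNhd n (t n)) ≤
        5 / 2 * ((∑ k ∈ Finset.Ico m n, t k) * t n) := by
      rw [Set.iUnion₂_inter, Finset.sum_mul, Finset.mul_sum]
      refine (measureReal_biUnion_finset_le _ _).trans (Finset.sum_le_sum fun k hk => ?_)
      exact volume_fareyNhd_inter_le (Finset.mem_Ico.mp hk).2 (ht0 k) (ht0 n) (ht n)
    have hn := le_volume_fareyNhd (k := n) (ht0 n) (ht n)
    rw [Finset.sum_Ico_succ_top hmn, ← Finset.insert_Ico_right_eq_Ico_add_one hmn,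
      Finset.set_biUnion_insert, Set.union_comm]
    nlinarith [sq_nonneg (t n)]

/-- If `∑ t k` diverges, the limsup of the neighbourhoods has positive measure. -/
lemma volume_limsup_fareyNhd_ne_zero {t : ℕ → ℝ} (ht0 : ∀ k, 0 ≤ t k) (ht : ∀ k, t k ≤ 1 / 80)
    (hsum : ¬ Summable t) :
    volume (⋂ m, ⋃ k ≥ m, fareyNhd k (t k)) ≠ 0 := by
  have hsub : ∀ m, (⋃ k ≥ m, fareyNhd k (t k)) ⊆ Set.Ioc 0 1 := fun m =>
    Set.iUnion₂_subset fun k _ => fareyNhd_subset (ht k)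
  have hfin : ∀ m, volume (⋃ k ≥ m, fareyNhd k (t k)) ≠ ⊤ := fun m =>
    ((measure_mono (hsub m)).trans_lt measure_Ioc_lt_top).ne
  have hle : ∀ m, ENNReal.ofReal (1 / 2560) ≤ volume (⋃ k ≥ m, fareyNhd k (t k)) := by
    intro m
    have hex : ∃ n, 1 / 80 ≤ ∑ k ∈ Finset.Ico m n, t k := by
      by_contra! hcon
      apply hsum
      rw [← summable_nat_add_iff m]
      refine summable_of_sum_range_le (c := 1 / 80) (fun _ => ht0 _) fun n => ?_
      have := (hcon (m + n)).le
      rw [Finset.sum_Ico_eq_sum_range, Nat.add_sub_cancel_left] at this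
      simpa only [add_comm] using this
    classical
    obtain ⟨hS, hmin⟩ := And.intro (Nat.find_spec hex) (fun j => Nat.find_min (m := j) hex)
    set n := Nat.find hex
    have hS' : ∑ k ∈ Finset.Ico m n, t k ≤ 1 / 40 := by
      have hmn : m < n := by
        by_contra! h
        rw [Finset.Ico_eq_empty_of_le h, Finset.sum_empty] at hS
        norm_num at hS
      obtain ⟨j, hj⟩ : ∃ j, n = j + 1 := ⟨n - 1, by omega⟩
      have h1 := hmin j (by omega)
      rw [hj, Finset.sum_Ico_succ_top (by omega)]
      linarith [ht j]
    have hb := le_volume_biUnion_fareyNhd ht0 ht m n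
    have hmono : volume.real (⋃ k ∈ Finset.Ico m n, fareyNhd k (t k)) ≤
        volume.real (⋃ k ≥ m, fareyNhd k (t k)) := by
      refine measureReal_mono ?_ (hfin m)
      exact Set.biUnion_mono (fun k hk => (Finset.mem_Ico.mp hk).1) fun _ _ => subset_rfl
    refine ENNReal.ofReal_le_of_le_toReal ?_
    change _ ≤ volume.real _
    nlinarith
  have hlim := tendsto_measure_iInter_atTop (μ := volume)
    (s := fun m => ⋃ k ≥ m, fareyNhd k (t k))
    (fun m => (MeasurableSet.iUnion fun k => MeasurableSet.iUnion fun _ =>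
      measurableSet_fareyNhd k (t k)).nullMeasurableSet)
    (fun m m' h => Set.biUnion_mono (fun k hk => le_trans h hk) fun _ _ => subset_rfl)
    ⟨0, hfin 0⟩
  have := ge_of_tendsto' hlim hle
  exact (lt_of_lt_of_le (by simp) this).ne'

lemma nint_le (x : ℝ) (z : ℤ) : nint x ≤ |x - z| :=
  ciInf_le ⟨0, by rintro _ ⟨z, rfl⟩; exact abs_nonneg _⟩ z

lemma nint_nonneg (x : ℝ) : 0 ≤ nint x := Real.iInf_nonneg fun _ => abs_nonneg _

lemma nint_le_one (x : ℝ) : nint x ≤ 1 :=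
  (nint_le x (round x)).trans ((abs_sub_round x).trans (by norm_num))

lemma not_summable_min {s : ℕ → ℝ} {c : ℝ} (hc : 0 < c) (hs : ¬ Summable s) :
    ¬ Summable fun k => min (s k) c := by
  intro h
  apply hs
  refine h.congr_atTop ?_
  filter_upwards [h.tendsto_atTop_zero.eventually_lt_const hc] with k hk
  rcases min_lt_iff.mp hk with h | h
  · exact min_eq_left h.le
  · exact absurd h (lt_irrefl _)

lemma not_summable_condensed {ψ : ℕ → ℝ} (hpos : ∀ q, 0 < ψ q) (hdec : Antitone ψ)
    (hsum : ¬ Summable ψ) : ¬ Summable fun k : ℕ => (32 : ℝ) ^ (k + 1) * ψ (32 ^ (k + 1)) := by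
  intro h
  apply hsum
  rw [summable_nat_add_iff 1 (f := fun k : ℕ => (32 : ℝ) ^ k * ψ (32 ^ k))] at h
  rw [← summable_schlomilch_iff_of_nonneg (C := 32) (u := fun k => 32 ^ k)
    (fun n => (hpos n).le) (fun m n _ hmn => hdec hmn) (fun n => by positivity)
    (pow_right_strictMono₀ (by norm_num)) (by norm_num) ?_]
  · refine (h.mul_left 31).congr fun k => ?_
    push_cast
    ring
  · intro n
    simp only [smul_eq_mul, pow_succ]
    omega

/-- **Khinchin's theorem**, divergence case. -/
lemma ae_infinite_nint_lt {ψ : ℕ → ℝ} (hpos : ∀ q, 0 < ψ q) (hdec : Antitone ψ)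
    (hsum : ¬ Summable ψ) :
    ∀ᵐ x : ℝ, x ∈ Set.Ioc (0 : ℝ) 1 → {q : ℕ | 0 < q ∧ nint (q * x) < ψ q}.Infinite := by
  set δ : ℕ → ℝ := fun q => ψ q / q with hδ
  have hδ0 : Filter.Tendsto δ Filter.atTop (nhds 0) := by
    refine squeeze_zero (fun q => div_nonneg (hpos q).le q.cast_nonneg)
      (fun q => div_le_div_of_nonneg_right (hdec (Nat.zero_le q)) q.cast_nonneg)
      (tendsto_const_div_atTop_nhds_zero_nat (ψ 0))
  have hmp := UnitAddCircle.measurePreserving_mk 0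
  rw [zero_add] at hmp
  set t : ℕ → ℝ := fun k => min ((32 : ℝ) ^ (k + 1) * ψ (32 ^ (k + 1))) (1 / 80) with ht
  have ht0 : ∀ k, 0 ≤ t k := fun k =>
    le_min (mul_nonneg (by positivity) (hpos _).le) (by norm_num)
  have ht1 : ∀ k, t k ≤ 1 / 80 := fun k => min_le_right _ _
  have htsum : ¬ Summable t :=
    not_summable_min (by norm_num) (not_summable_condensed hpos hdec hsum)
  have hmem : ∀ x ∈ ⋂ m, ⋃ k ≥ m, fareyNhd k (t k),
      (x : UnitAddCircle) ∈ addWellApproximable UnitAddCircle δ := by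
    intro x hx
    rw [UnitAddCircle.mem_addWellApproximable_iff, Set.infinite_iff_exists_gt]
    intro N
    rw [Set.mem_iInter] at hx
    have hxN := hx N
    simp only [fareyNhd, Set.mem_iUnion, exists_prop, Metric.mem_ball, Real.dist_eq] at hxN
    obtain ⟨k, hk, y, hy, hxy⟩ := hxN
    obtain ⟨a, q, ha, haq, hco, hkq, hq, rfl⟩ := exists_of_mem_fareyBlock hy
    have hNq : N < q := (hk.trans (Nat.lt_pow_self (by norm_num)).le).trans_lt hkq
    refine ⟨q, ⟨a, haq, hco, ?_⟩, hNq⟩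
    have hq0 : (0 : ℝ) < q := by exact_mod_cast (by omega : 0 < q)
    have hq' : (q : ℝ) ≤ 32 ^ (k + 1) := by exact_mod_cast hq
    rw [← AddCircle.coe_sub, UnitAddCircle.norm_eq]
    calc _ ≤ |x - a / q - (0 : ℤ)| := round_le _ _
      _ = |x - a / q| := by simp
      _ < _ := hxy
      _ ≤ (32 : ℝ) ^ (k + 1) * ψ (32 ^ (k + 1)) / ((32 : ℝ) ^ (k + 1)) ^ 2 := by
        gcongr; exact min_le_left _ _
      _ = ψ (32 ^ (k + 1)) / (32 : ℝ) ^ (k + 1) := by field_simp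
      _ ≤ ψ q / q := by
        gcongr
        · exact (hpos _).le
        · exact hdec hq
  have hae : ∀ᵐ x : UnitAddCircle, x ∈ addWellApproximable UnitAddCircle δ := by
    refine (AddCircle.addWellApproximable_ae_empty_or_univ δ hδ0).resolve_left fun h => ?_
    have h' := hmp.quasiMeasurePreserving.ae h
    rw [ae_restrict_iff' measurableSet_Ioc] at h'
    refine volume_limsup_fareyNhd_ne_zero ht0 ht1 htsum (measure_mono_null ?_ h')
    intro x hx hcon
    refine hcon ?_ (hmem x hx)
    obtain ⟨k, -, hk⟩ := Set.mem_iUnion₂.mp (Set.mem_iInter.mp hx 0)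
    exact fareyNhd_subset (ht1 k) hk
  have hae' := hmp.quasiMeasurePreserving.ae hae
  rw [ae_restrict_iff' measurableSet_Ioc] at hae'
  filter_upwards [hae'] with x hx hx01
  refine ((UnitAddCircle.mem_addWellApproximable_iff _ _).mp (hx hx01)).mono ?_
  rintro q ⟨a, haq, -, h⟩
  have hq : 0 < q := by omega
  have hq0 : (0 : ℝ) < q := by exact_mod_cast hq
  refine ⟨hq, ?_⟩
  rw [← AddCircle.coe_sub, UnitAddCircle.norm_eq, hδ, lt_div_iff₀ hq0] at h
  refine (nint_le _ (a + round (x - a / q) * q)).trans_lt (lt_of_eq_of_lt ?_ h)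
  rw [← abs_of_pos hq0, ← abs_mul, abs_of_pos hq0]
  congr 1
  push_cast
  field_simp
  ring

lemma summable_log_pow_div_pow {n : ℕ} (hn : 2 ≤ n) :
    Summable fun h : ℕ => Real.log h ^ (n - 1) / (h : ℝ) ^ n := by
  have hO : (fun h : ℕ => Real.log h ^ (n - 1) / (h : ℝ) ^ n) =O[Filter.atTop]
      fun h : ℕ => (h : ℝ) ^ (-(3 / 2) : ℝ) := by
    have h1 := ((isLittleO_log_rpow_rpow_atTop ((n - 1 : ℕ) : ℝ) (s := 1 / 2)
      (by norm_num)).comp_tendsto tendsto_natCast_atTop_atTop).isBigO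
    refine Asymptotics.IsBigO.trans (Filter.EventuallyEq.isBigO (Filter.Eventually.of_forall
      fun h => ?_)) ((h1.mul (Asymptotics.isBigO_refl (fun h : ℕ => ((h : ℝ) ^ n)⁻¹)
        Filter.atTop)).trans ?_)
    · simp [div_eq_mul_inv]
    · refine Asymptotics.IsBigO.of_bound 1 ?_
      filter_upwards [Filter.eventually_ge_atTop 1] with h hh
      have hh1 : (1 : ℝ) ≤ h := by exact_mod_cast hh
      have hh0 : (0 : ℝ) < h := by linarith
      simp only [Function.comp_apply]
      rw [one_mul, Real.norm_of_nonneg (by positivity), Real.norm_of_nonneg (by positivity),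
        ← Real.rpow_natCast, ← Real.rpow_neg hh0.le, ← Real.rpow_add hh0]
      refine Real.rpow_le_rpow_of_exponent_le hh1 ?_
      have : (2 : ℝ) ≤ n := by exact_mod_cast hn
      linarith
  exact summable_of_isBigO_nat (Real.summable_nat_rpow.mpr (by norm_num)) hO

lemma frequently_inv_le {n : ℕ} (hn : 2 ≤ n) {ψ : ℕ → ℝ} (hpos : ∀ q, 0 < ψ q)
    (hsum : ¬ Summable (fun h : ℕ => ψ h ^ n * Real.log h ^ (n - 1))) :
    ∃ᶠ q : ℕ in Filter.atTop, 1 / (q : ℝ) ≤ ψ q := by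
  intro hcon
  apply hsum
  refine summable_of_isBigO_nat (summable_log_pow_div_pow hn) (Asymptotics.IsBigO.of_bound 1 ?_)
  filter_upwards [hcon, Filter.eventually_ge_atTop 1] with q hq hq1
  have hlog : 0 ≤ Real.log q := Real.log_natCast_nonneg q
  have hψ := (hpos q).le
  rw [one_mul, Real.norm_of_nonneg (by positivity), Real.norm_of_nonneg (by positivity),
    div_eq_mul_one_div, mul_comm, ← one_div_pow]
  gcongr
  exact (not_le.mp hq).le

/-- Dirichlet's theorem gives infinitely many `q` with `‖q ξ‖ < ψ q` for every irrational `ξ`. -/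
lemma Irrational.infinite_nint_lt {ξ : ℝ} (hξ : Irrational ξ) {ψ : ℕ → ℝ} (hdec : Antitone ψ)
    (hψ : ∃ᶠ q : ℕ in Filter.atTop, 1 / (q : ℝ) ≤ ψ q) :
    {q : ℕ | 0 < q ∧ nint (q * ξ) < ψ q}.Infinite := by
  intro hfin
  have hlt : ∀ᶠ Q : ℕ in Filter.atTop, ∀ q ∈ {q : ℕ | 0 < q ∧ nint (q * ξ) < ψ q},
      1 / ((Q : ℝ) + 1) < |q * ξ - round (q * ξ)| := by
    rw [Filter.eventually_all_finite hfin]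
    rintro q ⟨hq, -⟩
    refine tendsto_one_div_add_atTop_nhds_zero_nat.eventually_lt_const ?_
    rw [abs_pos, sub_ne_zero]
    exact (hξ.natCast_mul hq.ne').ne_int _
  obtain ⟨Q, hQψ, hQ, hQ0⟩ :=
    (hψ.and_eventually (hlt.and (Filter.eventually_gt_atTop 0))).exists
  obtain ⟨q, hq0, hqQ, hq⟩ := Real.exists_nat_abs_mul_sub_round_le ξ hQ0
  refine (hQ q ⟨hq0, ?_⟩).not_ge hq
  have hQ0' : (0 : ℝ) < Q := by exact_mod_cast hQ0
  calc nint (q * ξ) ≤ 1 / ((Q : ℝ) + 1) := (nint_le _ _).trans hq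
    _ < 1 / (Q : ℝ) := by gcongr; linarith
    _ ≤ ψ Q := hQψ
    _ ≤ ψ q := hdec hqQ

lemma mem_SnStar_of_infinite {n : ℕ} {ψ : ℕ → ℝ} {x : Fin n → ℝ} (i : Fin n)
    (h : {q : ℕ | 0 < q ∧ nint (q * x i) < ψ q}.Infinite) : x ∈ SnStar n ψ := by
  refine h.mono ?_
  rintro q ⟨hq, hlt⟩
  refine ⟨hq, lt_of_le_of_lt ?_ hlt⟩
  rw [← Finset.mul_prod_erase _ _ (Finset.mem_univ i)]
  exact mul_le_of_le_one_right (nint_nonneg _)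
    (Finset.prod_le_one (fun _ _ => nint_nonneg _) fun _ _ => nint_le_one _)

/-- **Gallagher's theorem, divergence case**: if `Σ_h ψ(h)ⁿ (log h)^{n-1} = ∞` then
`S_n*(ψ)` has full `n`-dimensional Lebesgue measure, i.e. its complement in `[0,1]ⁿ`
is Lebesgue-null. -/
theorem gallagher_divergence (n : ℕ) (hn : 1 ≤ n) (ψ : ℕ → ℝ)
    (hpos : ∀ q, 0 < ψ q) (hdec : Antitone ψ)
    (hsum : ¬ Summable (fun h : ℕ => ψ h ^ n * Real.log h ^ (n - 1))) :
    volume ((Set.univ.pi fun _ => Set.Icc (0 : ℝ) 1) \ SnStar n ψ) = 0 := by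
  have hae : ∀ᵐ y : ℝ, y ∈ Set.Ioc (0 : ℝ) 1 →
      {q : ℕ | 0 < q ∧ nint (q * y) < ψ q}.Infinite := by
    rcases hn.eq_or_lt with rfl | hn
    · exact ae_infinite_nint_lt hpos hdec (by simpa using hsum)
    · filter_upwards [(Set.countable_range ((↑) : ℚ → ℝ)).ae_notMem volume] with y hy _
      exact Irrational.infinite_nint_lt hy hdec (frequently_inv_le hn hpos hsum)
  have hne : ∀ᵐ y : ℝ, y ≠ 0 := by simp [ae_iff]
  have hev := (Measure.quasiMeasurePreserving_eval (fun _ : Fin n => (volume : Measure ℝ))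
    ⟨0, hn⟩).ae (hae.and hne)
  rw [← volume_pi] at hev
  refine measure_mono_null ?_ hev
  rintro x ⟨hx, hxS⟩ ⟨h1, h2⟩
  have hx0 := hx ⟨0, hn⟩ trivial
  exact hxS (mem_SnStar_of_infinite ⟨0, hn⟩ (h1 ⟨lt_of_le_of_ne hx0.1 (Ne.symm h2), hx0.2⟩))
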